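/- Let A be an oPG, i an entrance of A, and q a query on A. Then the node i is winning in the parity game L(A, i, q) if and only if there exists a result r with A(q) ⪯_U r and r ∈ Pr(A, i). -/

import Mathlib

open scoped Classical

/-! ## Priorities and the sub-priority order -/

/-- The sub-priority order `⪯_P` on natural-number priorities:
`m1 ⪯_P m2` iff (both odd and `m2 ≤ m1`) or (`m1` odd and `m2` even)
or (both even and `m1 ≤ m2`). -/
def SubPrio (m1 m2 : ℕ) : Prop :=
  (Odd m1 ∧ Odd m2 ∧ m2 ≤ m1) ∨ (Odd m1 ∧ Even m2) ∨ (Even m1 ∧ Even m2 ∧ m1 ≤ m2)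

/-- The dual `m†` of a priority. -/
def dualP (m : ℕ) : ℕ := if m % 2 = 1 then m + 1 else if m = 0 then 0 else m - 1

/-! ## (Open) parity games -/

/-- A raw parity game over the node type `V`: node ownership (`eve v = true`
means `v` is owned by Player ∃), the edge relation, and the priority labelling. -/
structure PreGame (V : Type) where
  eve : V → Bool
  E : V → V → Prop
  Ω : V → V → ℕ

/-- A raw open parity game: a parity game together with lists of rightward and
leftward entrances and exits. -/
structure PreOPG (V : Type) extends PreGame V where
  Iright : List V
  Ileft : List V
  Oright : List V
  Oleft : List V

variable {V W : Type}

/-- The entrances of an open parity game. -/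
def PreOPG.ent (A : PreOPG V) : List V := A.Iright ++ A.Ileft

/-- The exits of an open parity game. -/
def PreOPG.exits (A : PreOPG V) : List V := A.Oright ++ A.Oleft

/-- Well-formedness of an open parity game (with maximal priority `M`). -/
structure OPGwf (M : ℕ) (A : PreOPG V) : Prop where
  nonempty : Nonempty V
  finite : Finite V
  succ : ∀ v, ∃ v', A.E v v'
  prio_le : ∀ v v', A.E v v' → A.Ω v v' ≤ M
  ends_eve : ∀ v ∈ A.ent ++ A.exits, A.eve v = true
  ends_nodup : (A.ent ++ A.exits).Nodup
  exit_sink : ∀ o ∈ A.exits, ∀ v, A.E o v → v = o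
  exit_self : ∀ o ∈ A.exits, A.E o o ∧ A.Ω o o = 0

/-! ## Strategies and plays -/

/-- An ∃-strategy: given the strict history and the current node (together a
finite path ending in the current node), pick a successor; it must follow
edges at nodes owned by Player ∃. -/
def IsEStrat (G : PreGame V) (σ : List V → V → V) : Prop :=
  ∀ h v, G.eve v = true → G.E v (σ h v)

/-- A ∀-strategy. -/
def IsAStrat (G : PreGame V) (σ : List V → V → V) : Prop :=
  ∀ h v, G.eve v = false → G.E v (σ h v)

/-- A strategy is positional if it only depends on the last node of the path. -/
def Positional (σ : List V → V → V) : Prop := ∀ h h' v, σ h v = σ h' v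

/-- The pair (strict history, current node) after `n` steps of the play
from `v` induced by the strategies `σe, σa`. -/
def playPath (G : PreGame V) (σe σa : List V → V → V) (v : V) : ℕ → List V × V
  | 0 => ([], v)
  | n + 1 =>
      let hc := playPath G σe σa v n
      (hc.1 ++ [hc.2], if G.eve hc.2 then σe hc.1 hc.2 else σa hc.1 hc.2)

/-- The play from `v` induced by the strategies `σe, σa`. -/
def playSeq (G : PreGame V) (σe σa : List V → V → V) (v : V) (n : ℕ) : V :=
  (playPath G σe σa v n).2

/-- The parity condition: the maximum priority occurring infinitely often
along the play is even. -/
def PlayWins (G : PreGame V) (p : ℕ → V) : Prop :=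
  ∃ m, Even m ∧ (∃ᶠ j in Filter.atTop, G.Ω (p j) (p (j + 1)) = m) ∧
    ∀ m', (∃ᶠ j in Filter.atTop, G.Ω (p j) (p (j + 1)) = m') → m' ≤ m

/-- A node of a parity game is winning (for Player ∃) if some ∃-strategy beats
every ∀-strategy from that node. -/
def WinningNode (G : PreGame V) (v : V) : Prop :=
  ∃ σe, IsEStrat G σe ∧ ∀ σa, IsAStrat G σa → PlayWins G (playSeq G σe σa v)

/-! ## The domain of an open parity game and denotations -/

/-- The carrier of the domain `D(A) = {⊥, ⊤} ∪ (O × ℙ)` of an oPG. -/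
inductive Dom (V : Type) where
  | bot : Dom V
  | top : Dom V
  | ex : V → ℕ → Dom V

/-- The domain order `⪯_D`. -/
def DomLE (d1 d2 : Dom V) : Prop :=
  d1 = Dom.bot ∨ d2 = Dom.top ∨
    ∃ o m1 m2, d1 = Dom.ex o m1 ∧ d2 = Dom.ex o m2 ∧ SubPrio m1 m2

/-- Membership in the domain `D(A)` (exit points carry exits of `A` and
priorities bounded by `M`). -/
def InDom (M : ℕ) (A : PreOPG V) (d : Dom V) : Prop :=
  ∀ o m, d = Dom.ex o m → o ∈ A.exits ∧ m ≤ M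

/-- Mapping domain elements along a renaming of exits. -/
def Dom.map (f : V → W) : Dom V → Dom W
  | .bot => .bot
  | .top => .top
  | .ex o m => .ex (f o) m

/-- The denotation of a play, as a relation: `PlayDen A p d` holds iff `⟦p⟧ = d`. -/
def PlayDen (A : PreOPG V) (p : ℕ → V) (d : Dom V) : Prop :=
  (∃ j, p j ∈ A.exits ∧ (∀ k, k < j → p k ∉ A.exits) ∧
      d = Dom.ex (p j) ((Finset.range j).sup fun k => A.Ω (p k) (p (k + 1)))) ∨
  ((∀ j, p j ∉ A.exits) ∧ PlayWins A.toPreGame p ∧ d = Dom.top) ∨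
  ((∀ j, p j ∉ A.exits) ∧ ¬ PlayWins A.toPreGame p ∧ d = Dom.bot)

/-- `{ ⟦play(σe, σa, i)⟧ : σa a ∀-strategy }`. -/
def denSet (A : PreOPG V) (σe : List V → V → V) (i : V) : Set (Dom V) :=
  { d | ∃ σa, IsAStrat A.toPreGame σa ∧ PlayDen A (playSeq A.toPreGame σe σa i) d }

/-- `Min(T)`: the set of `⪯_D`-minimal elements of `T`. -/
def minSet (T : Set (Dom V)) : Set (Dom V) :=
  { d | d ∈ T ∧ ∀ d' ∈ T, DomLE d' d → d' = d }

/-- The upper preorder `⪯_U` on subsets of the domain. -/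
def UpLE (T1 T2 : Set (Dom V)) : Prop := ∀ d2 ∈ T2, ∃ d1 ∈ T1, DomLE d1 d2

/-- `Max(S)`: the set of `⪯_U`-maximal elements of `S`. -/
def maxSets (S : Set (Set (Dom V))) : Set (Set (Dom V)) :=
  { T | T ∈ S ∧ ∀ T' ∈ S, UpLE T T' → UpLE T' T }

/-- The Pareto front `Pr(A, i)` of an oPG `A` at an entrance `i`. -/
def pareto (A : PreOPG V) (i : V) : Set (Set (Dom V)) :=
  maxSets { T | ∃ σe, IsEStrat A.toPreGame σe ∧ T = minSet (denSet A σe i) }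

/-- The denotation `⟦i⟧` of an entrance `i`. -/
def denEntrance (A : PreOPG V) (i : V) : Set (Set (Dom V)) :=
  { T | ∃ σe, IsEStrat A.toPreGame σe ∧ T = denSet A σe i }

/-- The entrance `i` is winning if `{⊤} ∈ ⟦i⟧`. -/
def WinningEnt (A : PreOPG V) (i : V) : Prop :=
  ({Dom.top} : Set (Dom V)) ∈ denEntrance A i

/-- The entrance `i` is losing if `⊥ ∈ T` for every `T ∈ ⟦i⟧`. -/
def LosingEnt (A : PreOPG V) (i : V) : Prop :=
  ∀ T ∈ denEntrance A i, Dom.bot ∈ T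

/-- The entrance `i` is pending if it is neither winning nor losing. -/
def PendingEnt (A : PreOPG V) (i : V) : Prop :=
  ¬ WinningEnt A i ∧ ¬ LosingEnt A i

/-- A result: a nonempty antichain in the domain `D(A)`. -/
def IsResult (M : ℕ) (A : PreOPG V) (r : Set (Dom V)) : Prop :=
  r.Nonempty ∧ minSet r = r ∧ ∀ d ∈ r, InDom M A d

/-! ## Queries, duals and the loop construction -/

/-- A query assigns to each exit a priority or `⊥` (`none`);
well-formedness: its priority values on exits are bounded by `M`. -/
def QueryWF (M : ℕ) (A : PreOPG V) (q : V → Option ℕ) : Prop :=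
  ∀ o ∈ A.exits, ∀ m, q o = some m → m ≤ M

/-- Equality of queries (as functions on the exits). -/
def QueryEq (A : PreOPG V) (q q' : V → Option ℕ) : Prop :=
  ∀ o ∈ A.exits, q o = q' o

/-- The (pointwise) query order. -/
def QueryLE (A : PreOPG V) (q q' : V → Option ℕ) : Prop :=
  ∀ o ∈ A.exits, q o = none ∨ ∃ m m', q o = some m ∧ q' o = some m' ∧ SubPrio m m'

/-- The dual `A(q)` of a query `q`. -/
def queryDual (A : PreOPG V) (q : V → Option ℕ) : Set (Dom V) :=
  { d | ((∀ o ∈ A.exits, q o = none) ∧ d = Dom.top) ∨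
        (∃ o ∈ A.exits, ∃ m, q o = some m ∧ d = Dom.ex o (dualP m)) }

/-- The loop construction `L(A, i, q)`: keep all edges not leaving an exit;
from each exit `o` with `q o = some m` add an edge to `i` with priority `m`;
from each exit `o` with `q o = none` add a self-loop with priority `1`. -/
noncomputable def loopPG (A : PreOPG V) (i : V) (q : V → Option ℕ) : PreGame V where
  eve := A.eve
  E := fun v v' =>
    (A.E v v' ∧ v ∉ A.exits) ∨
    (v ∈ A.exits ∧ (∃ m, q v = some m) ∧ v' = i) ∨
    (v ∈ A.exits ∧ q v = none ∧ v' = v)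
  Ω := fun v v' =>
    if v ∈ A.exits then (match q v with | some m => m | none => 1) else A.Ω v v'

/-! ## The shortcut construction -/

/-- The shortcut oPG `S(A)`: its nodes are the open ends of `A` (owned by
Player ∃) together with one ∀-node `(i, r)` for each entrance `i` and each
Pareto-optimal result `r ∈ Pr(A, i)`. -/
noncomputable def shortcut (A : PreOPG V) : PreOPG (V ⊕ (V × Set (Dom V))) where
  eve := fun x => match x with | .inl _ => true | .inr _ => false
  E := fun x y => match x, y with
    | .inl v, .inr (i, r) => v = i ∧ i ∈ A.ent ∧ r ∈ pareto A i
    | .inr (i, r), .inl o => i ∈ A.ent ∧ r ∈ pareto A i ∧ ∃ m, Dom.ex o m ∈ r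
    | .inl o, .inl o' => o ∈ A.exits ∧ o' = o
    | .inr (i, r), .inr (i', r') =>
        i = i' ∧ r = r' ∧ i ∈ A.ent ∧ r ∈ pareto A i ∧ (Dom.top ∈ r ∨ Dom.bot ∈ r)
  Ω := fun x y => match x, y with
    | .inl _, _ => 0
    | .inr (_, r), .inl o => sSup { m | Dom.ex o m ∈ r }
    | .inr (_, r), .inr _ => if Dom.bot ∈ r then 1 else 0
  Iright := A.Iright.map Sum.inl
  Ileft := A.Ileft.map Sum.inl
  Oright := A.Oright.map Sum.inl
  Oleft := A.Oleft.map Sum.inl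

/-! ## Sum and sequential composition -/

/-- The sum `A ⊕ B` of open parity games. -/
def sumOPG (A : PreOPG V) (B : PreOPG W) : PreOPG (V ⊕ W) where
  eve := Sum.elim A.eve B.eve
  E := fun x y => match x, y with
    | .inl v, .inl v' => A.E v v'
    | .inr w, .inr w' => B.E w w'
    | _, _ => False
  Ω := fun x y => match x, y with
    | .inl v, .inl v' => A.Ω v v'
    | .inr w, .inr w' => B.Ω w w'
    | _, _ => 0
  Iright := A.Iright.map Sum.inl ++ B.Iright.map Sum.inr
  Ileft := A.Ileft.map Sum.inl ++ B.Ileft.map Sum.inr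
  Oright := A.Oright.map Sum.inl ++ B.Oright.map Sum.inr
  Oleft := A.Oleft.map Sum.inl ++ B.Oleft.map Sum.inr

/-- The (bidirectional) sequential composition `A ⨟ B` of open parity games:
the `k`-th rightward exit of `A` is connected (with priority `0`) to the `k`-th
rightward entrance of `B`, and the `k`-th leftward exit of `B` to the `k`-th
leftward entrance of `A`. -/
def seqOPG (A : PreOPG V) (B : PreOPG W) : PreOPG (V ⊕ W) where
  eve := Sum.elim A.eve B.eve
  E := fun x y => match x, y with
    | .inl v, .inl v' => A.E v v' ∧ v ∉ A.Oright
    | .inr w, .inr w' => B.E w w' ∧ w ∉ B.Oleft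
    | .inl v, .inr w => ∃ k : ℕ, A.Oright[k]? = some v ∧ B.Iright[k]? = some w
    | .inr w, .inl v => ∃ k : ℕ, B.Oleft[k]? = some w ∧ A.Ileft[k]? = some v
  Ω := fun x y => match x, y with
    | .inl v, .inl v' => A.Ω v v'
    | .inr w, .inr w' => B.Ω w w'
    | _, _ => 0
  Iright := A.Iright.map Sum.inl
  Ileft := B.Ileft.map Sum.inr
  Oright := B.Oright.map Sum.inr
  Oleft := A.Oleft.map Sum.inl

/-- The sequential composition `A ⨟ B` is defined when the arities match. -/
def seqDefined (A : PreOPG V) (B : PreOPG W) : Prop :=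
  A.Oright.length = B.Iright.length ∧ B.Oleft.length = A.Ileft.length

/-! ## Entrance-dependent strategies on a sequential composition -/

/-- `i` is the last element of the list `p` that belongs to `I`. -/
def lastOcc {N : Type} (I : List N) (p : List N) (i : N) : Prop :=
  i ∈ I ∧ ∃ s t, p = s ++ i :: t ∧ ∀ x ∈ t, x ∉ I

/-- A positional ∃-strategy, given directly as a function on nodes. -/
def IsPosE (G : PreGame V) (s : V → V) : Prop := ∀ v, G.eve v = true → G.E v (s v)

/-- A positional ∀-strategy, given directly as a function on nodes. -/
def IsPosA (G : PreGame V) (s : V → V) : Prop := ∀ v, G.eve v = false → G.E v (s v)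

/-- Viewing a positional strategy as a history-dependent strategy. -/
def liftPos (s : V → V) : List V → V → V := fun _ v => s v

/-- All the entrances of the two components of a sequential composition. -/
def seqEnts (A : PreOPG V) (B : PreOPG W) : List (V ⊕ W) :=
  A.ent.map Sum.inl ++ B.ent.map Sum.inr

/-- `σ` is an entrance-dependent ∃-strategy on `A ⨟ B` with component families
`σA` (over entrances of `A`) and `σB` (over entrances of `B`). -/
def EntDepE (A : PreOPG V) (B : PreOPG W)
    (σ : List (V ⊕ W) → (V ⊕ W) → (V ⊕ W))
    (σA : V → V → V) (σB : W → W → W) : Prop :=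
  IsEStrat (seqOPG A B).toPreGame σ ∧
  (∀ i' ∈ A.ent, IsPosE A.toPreGame (σA i')) ∧
  (∀ i' ∈ B.ent, IsPosE B.toPreGame (σB i')) ∧
  (∀ h v, (seqOPG A B).eve v = true →
    (∀ i' x, lastOcc (seqEnts A B) (h ++ [v]) (Sum.inl i') → v = Sum.inl x →
        σ h v = Sum.inl (σA i' x)) ∧
    (∀ i' x, lastOcc (seqEnts A B) (h ++ [v]) (Sum.inr i') → v = Sum.inr x →
        σ h v = Sum.inr (σB i' x)))

/-- `σ` is an entrance-dependent ∀-strategy on `A ⨟ B` with component families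
`σA` and `σB`. -/
def EntDepA (A : PreOPG V) (B : PreOPG W)
    (σ : List (V ⊕ W) → (V ⊕ W) → (V ⊕ W))
    (σA : V → V → V) (σB : W → W → W) : Prop :=
  IsAStrat (seqOPG A B).toPreGame σ ∧
  (∀ i' ∈ A.ent, IsPosA A.toPreGame (σA i')) ∧
  (∀ i' ∈ B.ent, IsPosA B.toPreGame (σB i')) ∧
  (∀ h v, (seqOPG A B).eve v = false →
    (∀ i' x, lastOcc (seqEnts A B) (h ++ [v]) (Sum.inl i') → v = Sum.inl x →
        σ h v = Sum.inl (σA i' x)) ∧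
    (∀ i' x, lastOcc (seqEnts A B) (h ++ [v]) (Sum.inr i') → v = Sum.inr x →
        σ h v = Sum.inr (σB i' x)))

/-- `σ` is an entrance-dependent ∀-strategy (for some component families). -/
def IsEntDepA (A : PreOPG V) (B : PreOPG W)
    (σ : List (V ⊕ W) → (V ⊕ W) → (V ⊕ W)) : Prop :=
  ∃ σA σB, EntDepA A B σ σA σB

/-! ## The largest value occurring infinitely often -/

/-- `m` is the largest value that the sequence `w` takes infinitely often. -/
def IsLimMax (w : ℕ → ℕ) (m : ℕ) : Prop :=
  (∃ᶠ j in Filter.atTop, w j = m) ∧ ∀ m', (∃ᶠ j in Filter.atTop, w j = m') → m' ≤ m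

theorem IsLimMax.unique {w : ℕ → ℕ} {m m' : ℕ} (h : IsLimMax w m) (h' : IsLimMax w m') :
    m = m' :=
  le_antisymm (h'.2 m h.1) (h.2 m' h'.1)

theorem exists_isLimMax {w : ℕ → ℕ} {B : ℕ} (hb : ∀ j, w j ≤ B) : ∃ m, IsLimMax w m := by
  have hne : {m | ∃ᶠ j in Filter.atTop, w j = m}.Nonempty := by
    by_contra hcon
    have hev : ∀ m ∈ Finset.range (B + 1), ∀ᶠ j in Filter.atTop, w j ≠ m := by
      intro m _
      by_contra hm
      exact hcon ⟨m, fun h => hm h⟩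
    rw [← Filter.eventually_all_finset] at hev
    obtain ⟨j, hj⟩ := hev.exists
    exact hj (w j) (Finset.mem_range.2 (Nat.lt_succ_of_le (hb j))) rfl
  have hfin : {m | ∃ᶠ j in Filter.atTop, w j = m}.Finite := by
    refine (Set.finite_Iic B).subset fun m hm => ?_
    obtain ⟨j, hj⟩ := Filter.Frequently.exists hm
    exact hj ▸ hb j
  obtain ⟨m, hm, hmax⟩ := Set.exists_max_image _ id hfin hne
  exact ⟨m, hm, fun m' hm' => hmax m' hm'⟩

theorem IsLimMax.eventually_le {w : ℕ → ℕ} {B m : ℕ} (hb : ∀ j, w j ≤ B) (h : IsLimMax w m) :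
    ∀ᶠ j in Filter.atTop, w j ≤ m := by
  have hev : ∀ m' ∈ Finset.Ioc m B, ∀ᶠ j in Filter.atTop, w j ≠ m' := by
    intro m' hm'
    by_contra hcon
    have := h.2 m' fun h => hcon h
    have := (Finset.mem_Ioc.1 hm').1
    omega
  rw [← Filter.eventually_all_finset] at hev
  filter_upwards [hev] with j hj
  by_contra hlt
  exact hj (w j) (Finset.mem_Ioc.2 ⟨not_le.1 hlt, hb j⟩) rfl

theorem frequently_atTop_shift {P : ℕ → Prop} (N : ℕ) :
    (∃ᶠ j in Filter.atTop, P (N + j)) ↔ ∃ᶠ j in Filter.atTop, P j := by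
  have h := Filter.frequently_map (f := Filter.atTop) (m := fun j => j + N) (P := P)
  rw [Filter.map_add_atTop_eq_nat] at h
  simpa only [add_comm N] using h.symm

theorem isLimMax_shift {w : ℕ → ℕ} (N m : ℕ) :
    IsLimMax (fun j => w (N + j)) m ↔ IsLimMax w m := by
  unfold IsLimMax
  simp only [fun m => frequently_atTop_shift (P := fun j => w j = m) N]

theorem isLimMax_const (c : ℕ) : IsLimMax (fun _ => c) c := by
  refine ⟨Filter.Eventually.frequently (by simp), fun m' hm' => ?_⟩
  obtain ⟨_, hj⟩ := hm'.exists
  exact hj.ge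

/-- If a bounded sequence splits into consecutive finite segments whose maxima all satisfy `p`,
then so does its largest recurring value. -/
theorem exists_isLimMax_of_segments {w : ℕ → ℕ} {B : ℕ} (hb : ∀ j, w j ≤ B) (p : ℕ → Prop)
    (R : Set ℕ) (h0 : 0 ∈ R)
    (hR : ∀ N ∈ R, (∃ m, p m ∧ IsLimMax w m) ∨
      ∃ j, p ((Finset.range (j + 1)).sup fun k => w (N + k)) ∧ N + j + 1 ∈ R) :
    ∃ m, p m ∧ IsLimMax w m := by
  by_contra hcon
  simp only [hcon, false_or] at hR
  obtain ⟨m, hm⟩ := exists_isLimMax hb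
  obtain ⟨K, hK⟩ := Filter.eventually_atTop.1 (hm.eventually_le hb)
  have hlarge : ∀ n, ∃ N ∈ R, n ≤ N := by
    intro n
    induction n with
    | zero => exact ⟨0, h0, le_rfl⟩
    | succ n ih =>
      obtain ⟨N, hN, hle⟩ := ih
      obtain ⟨j, -, hj⟩ := hR N hN
      exact ⟨_, hj, by omega⟩
  have hno : ∀ d N, N ∈ R → K ≤ N → w (N + d) ≠ m := by
    intro d
    induction d using Nat.strong_induction_on with
    | _ d ih =>
      intro N hN hKN hd
      obtain ⟨j, hpj, hj⟩ := hR N hN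
      by_cases hdj : d ≤ j
      · have hsup : (Finset.range (j + 1)).sup (fun k => w (N + k)) = m := by
          refine le_antisymm (Finset.sup_le fun k _ => hK _ (by omega)) ?_
          rw [← hd]
          exact Finset.le_sup (f := fun k => w (N + k)) (Finset.mem_range.2 (by omega))
        exact hcon ⟨m, hsup ▸ hpj, hm⟩
      · refine ih (d - (j + 1)) (by omega) _ hj (by omega) ?_
        rw [← hd]
        congr 1
        omega
  obtain ⟨N, hN, hKN⟩ := hlarge K
  obtain ⟨t, ht, hwt⟩ := Filter.frequently_atTop.1 hm.1 N
  exact hno (t - N) N hN hKN (by rw [Nat.add_sub_cancel' ht]; exact hwt)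

/-! ## The domain order, minimal elements and maximal sets -/

theorem SubPrio.refl (m : ℕ) : SubPrio m m := by
  rcases Nat.even_or_odd m with h | h
  · exact Or.inr (Or.inr ⟨h, h, le_rfl⟩)
  · exact Or.inl ⟨h, h, le_rfl⟩

theorem SubPrio.trans {a b c : ℕ} (h : SubPrio a b) (h' : SubPrio b c) : SubPrio a c := by
  simp only [SubPrio, Nat.even_iff, Nat.odd_iff] at *
  omega

theorem SubPrio.antisymm {a b : ℕ} (h : SubPrio a b) (h' : SubPrio b a) : a = b := by
  simp only [SubPrio, Nat.even_iff, Nat.odd_iff] at *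
  omega

theorem DomLE.refl (d : Dom V) : DomLE d d := by
  cases d with
  | bot => exact Or.inl rfl
  | top => exact Or.inr (Or.inl rfl)
  | ex o m => exact Or.inr (Or.inr ⟨o, m, m, rfl, rfl, SubPrio.refl m⟩)

theorem DomLE.trans {a b c : Dom V} (h : DomLE a b) (h' : DomLE b c) : DomLE a c := by
  rcases h with rfl | rfl | ⟨o, m, n, rfl, rfl, h⟩
  · exact Or.inl rfl
  · rcases h' with h' | rfl | ⟨_, _, _, h', _⟩
    · cases h'
    · exact Or.inr (Or.inl rfl)
    · cases h'
  · rcases h' with h' | rfl | ⟨o', m', n', h1, rfl, h'⟩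
    · cases h'
    · exact Or.inr (Or.inl rfl)
    · cases h1
      exact Or.inr (Or.inr ⟨_, _, _, rfl, rfl, h.trans h'⟩)

theorem DomLE.antisymm {a b : Dom V} (h : DomLE a b) (h' : DomLE b a) : a = b := by
  rcases h with rfl | rfl | ⟨o, m, n, rfl, rfl, h⟩
  · rcases h' with rfl | h' | ⟨_, _, _, _, h', _⟩
    · rfl
    · cases h'
    · cases h'
  · rcases h' with h' | rfl | ⟨_, _, _, h', _⟩
    · cases h'
    · rfl
    · cases h'
  · rcases h' with h' | h' | ⟨o', m', n', h1, h2, h'⟩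
    · cases h'
    · cases h'
    · cases h1
      cases h2
      rw [h.antisymm h']

theorem UpLE.refl (T : Set (Dom V)) : UpLE T T := fun d hd => ⟨d, hd, DomLE.refl d⟩

theorem UpLE.trans {T₁ T₂ T₃ : Set (Dom V)} (h : UpLE T₁ T₂) (h' : UpLE T₂ T₃) :
    UpLE T₁ T₃ := by
  intro d hd
  obtain ⟨d', hd', hle⟩ := h' d hd
  obtain ⟨d'', hd'', hle'⟩ := h d' hd'
  exact ⟨d'', hd'', hle'.trans hle⟩

theorem Set.Finite.exists_rel_maximal {α : Type*} {r : α → α → Prop} (hrefl : ∀ a, r a a)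
    (htrans : ∀ a b c, r a b → r b c → r a c) {s : Set α} (hs : s.Finite) {a : α} (ha : a ∈ s) :
    ∃ b ∈ s, r a b ∧ ∀ c ∈ s, r b c → r c b := by
  let _ : Preorder α := { le := r, le_refl := hrefl, le_trans := htrans }
  obtain ⟨b, hab, hb⟩ := hs.exists_le_maximal ha
  exact ⟨b, hb.prop, hab, fun c hc hbc => hb.le_of_ge hc hbc⟩

theorem upLE_minSet {T : Set (Dom V)} (hT : T.Finite) : UpLE (minSet T) T := by
  intro d hd
  obtain ⟨b, hb, hbd, hmin⟩ := hT.exists_rel_maximal (r := fun x y => DomLE y x) DomLE.refl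
    (fun _ _ _ h h' => h'.trans h) hd
  exact ⟨b, ⟨hb, fun c hc hcb => hcb.antisymm (hmin c hc hcb)⟩, hbd⟩

/-! ## Plays -/

theorem playSeq_edge {G : PreGame V} {σe σa : List V → V → V} (he : IsEStrat G σe)
    (ha : IsAStrat G σa) (v : V) (n : ℕ) :
    G.E (playSeq G σe σa v n) (playSeq G σe σa v (n + 1)) := by
  simp only [playSeq, playPath]
  cases h : G.eve (playPath G σe σa v n).2 with
  | true => simpa [h] using he _ _ h
  | false => simpa [h] using ha _ _ h

theorem mem_playPath_fst {G : PreGame V} {σe σa : List V → V → V} {v x : V} {n : ℕ}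
    (hx : x ∈ (playPath G σe σa v n).1) : ∃ j < n, playSeq G σe σa v j = x := by
  induction n with
  | zero => simp [playPath] at hx
  | succ n ih =>
    simp only [playPath, List.mem_append, List.mem_singleton] at hx
    rcases hx with hx | rfl
    · obtain ⟨j, hj, h⟩ := ih hx
      exact ⟨j, by omega, h⟩
    · exact ⟨n, by omega, rfl⟩

theorem exists_playDen (A : PreOPG V) (p : ℕ → V) : ∃ d, PlayDen A p d := by
  by_cases h : ∃ j, p j ∈ A.exits
  · exact ⟨_, Or.inl ⟨Nat.find h, Nat.find_spec h, fun k hk => Nat.find_min h hk, rfl⟩⟩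
  · push Not at h
    by_cases hw : PlayWins A.toPreGame p
    · exact ⟨_, Or.inr (Or.inl ⟨h, hw, rfl⟩)⟩
    · exact ⟨_, Or.inr (Or.inr ⟨h, hw, rfl⟩)⟩

theorem inDom_of_mem_denSet {M : ℕ} {A : PreOPG V} (wf : OPGwf M A) {σe : List V → V → V}
    (he : IsEStrat A.toPreGame σe) {i : V} {d : Dom V} (hd : d ∈ denSet A σe i) :
    InDom M A d := by
  rintro o m rfl
  obtain ⟨σa, ha, ⟨j, hj, -, h⟩ | ⟨-, -, h⟩ | ⟨-, -, h⟩⟩ := hd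
  · cases h
    exact ⟨hj, Finset.sup_le fun k _ => wf.prio_le _ _ (playSeq_edge he ha i k)⟩
  · cases h
  · cases h

theorem finite_setOf_inDom (M : ℕ) (A : PreOPG V) : {d | InDom M A d}.Finite := by
  have hex : {o | o ∈ A.exits}.Finite := A.exits.finite_toSet
  refine (((hex.prod (Set.finite_Iic M)).image fun x => Dom.ex x.1 x.2).union
    (Set.toFinite {Dom.bot, Dom.top})).subset fun d hd => ?_
  cases d with
  | bot => simp
  | top => simp
  | ex o m => exact Or.inl ⟨(o, m), hd o m rfl, rfl⟩

theorem exists_mem_pareto {M : ℕ} {A : PreOPG V} (wf : OPGwf M A) {σe : List V → V → V}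
    (he : IsEStrat A.toPreGame σe) (i : V) :
    ∃ r ∈ pareto A i, UpLE (minSet (denSet A σe i)) r := by
  have hfin : {T | ∃ σe, IsEStrat A.toPreGame σe ∧ T = minSet (denSet A σe i)}.Finite := by
    refine (finite_setOf_inDom M A).finite_subsets.subset ?_
    rintro T ⟨τ, hτ, rfl⟩ d hd
    exact inDom_of_mem_denSet wf hτ hd.1
  obtain ⟨r, hr, hle, hmax⟩ := hfin.exists_rel_maximal (r := UpLE) UpLE.refl
    (fun _ _ _ => UpLE.trans) ⟨σe, he, rfl⟩
  exact ⟨r, ⟨hr, hmax⟩, hle⟩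

/-! ## Denotations that satisfy a query -/

/-- Closing the loop with the query `q` turns a segment of denotation `d` into one that is
favourable to Player ∃. -/
def Dom.Favourable (q : V → Option ℕ) : Dom V → Prop
  | .bot => False
  | .top => True
  | .ex o m => ∃ m', q o = some m' ∧ Even (max m m')

theorem subPrio_dualP_iff (m m' : ℕ) : SubPrio (dualP m') m ↔ Even (max m m') := by
  simp only [SubPrio, dualP, Nat.even_iff, Nat.odd_iff]
  rcases le_total m m' with h | h
  · rw [max_eq_right h]
    split_ifs <;> omega
  · rw [max_eq_left h]
    split_ifs <;> omega

theorem queryDual_nonempty (A : PreOPG V) (q : V → Option ℕ) : (queryDual A q).Nonempty := by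
  by_cases h : ∀ o ∈ A.exits, q o = none
  · exact ⟨_, Or.inl ⟨h, rfl⟩⟩
  · push Not at h
    obtain ⟨o, ho, hq⟩ := h
    obtain ⟨m, hm⟩ := Option.ne_none_iff_exists'.1 hq
    exact ⟨_, Or.inr ⟨o, ho, m, hm, rfl⟩⟩

theorem favourable_iff {M : ℕ} {A : PreOPG V} {q : V → Option ℕ} {d : Dom V}
    (hd : InDom M A d) : d.Favourable q ↔ ∃ d' ∈ queryDual A q, DomLE d' d := by
  cases d with
  | bot =>
    simp only [Dom.Favourable, false_iff]
    rintro ⟨d', ⟨-, rfl⟩ | ⟨o, -, m, -, rfl⟩, h | h | ⟨_, _, _, -, h, -⟩⟩ <;> cases h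
  | top =>
    obtain ⟨d', hd'⟩ := queryDual_nonempty A q
    exact ⟨fun _ => ⟨d', hd', Or.inr (Or.inl rfl)⟩, fun _ => trivial⟩
  | ex o m =>
    constructor
    · rintro ⟨m', hq, hev⟩
      exact ⟨_, Or.inr ⟨o, (hd o m rfl).1, m', hq, rfl⟩,
        Or.inr (Or.inr ⟨_, _, _, rfl, rfl, (subPrio_dualP_iff m m').2 hev⟩)⟩
    · rintro ⟨d', ⟨-, rfl⟩ | ⟨o', -, m', hq, rfl⟩, h | h | ⟨_, _, _, h1, h2, h⟩⟩
      all_goals first | cases h1 | cases h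
      cases h2
      exact ⟨m', hq, (subPrio_dualP_iff m m').1 h⟩

/-! ## Segments of plays in the loop construction -/

/-- The play in the loop construction is back at `i`, having just left an exit if it moved
at all; `P` is the history at that time. -/
def IsRestart (A : PreOPG V) (i : V) (q : V → Option ℕ) (σe σa : List V → V → V) (N : ℕ)
    (P : List V) : Prop :=
  playPath (loopPG A i q) σe σa i N = (P, i) ∧ ∀ x ∈ P.getLast?, x ∈ A.exits

theorem rtakeWhile_append_of_getLast? {p : V → Bool} {P h : List V}
    (hP : ∀ x ∈ P.getLast?, p x = false) (hh : ∀ x ∈ h, p x = true) :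
    (P ++ h).rtakeWhile p = h := by
  rw [List.rtakeWhile, List.reverse_append, List.takeWhile_append_of_pos (by simpa using hh)]
  rcases List.eq_nil_or_concat' P with rfl | ⟨P', o, rfl⟩
  · simp
  · simp [hP o (by simp)]

theorem rdropWhile_append_of_getLast? {p : V → Bool} {P h : List V}
    (hP : ∀ x ∈ P.getLast?, p x = false) (hh : ∀ x ∈ h, p x = true) :
    (P ++ h).rdropWhile p = P := by
  rw [List.rdropWhile, List.reverse_append, List.dropWhile_append_of_pos (by simpa using hh)]
  rcases List.eq_nil_or_concat' P with rfl | ⟨P', o, rfl⟩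
  · simp
  · simp [hP o (by simp)]

section Loop

variable {M : ℕ} {A : PreOPG V} {i : V} {q : V → Option ℕ} {σe σa τe τa : List V → V → V}
  {N : ℕ} {P : List V}

theorem playPath_loop_eq (hN : playPath (loopPG A i q) σe σa i N = (P, i))
    (hm : ∀ h v, (∀ x ∈ h, x ∉ A.exits) → v ∉ A.exits →
      (if A.eve v then τe h v else τa h v) = if A.eve v then σe (P ++ h) v else σa (P ++ h) v)
    {k : ℕ} (hk : ∀ j < k, playSeq A.toPreGame τe τa i j ∉ A.exits) :
    playPath (loopPG A i q) σe σa i (N + k) =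
      (P ++ (playPath A.toPreGame τe τa i k).1, (playPath A.toPreGame τe τa i k).2) := by
  induction k with
  | zero => simpa [playPath] using hN
  | succ k ih =>
    have ih := ih fun j hj => hk j (by omega)
    have hstep := hm (playPath A.toPreGame τe τa i k).1 (playPath A.toPreGame τe τa i k).2
      (fun x hx => by
        obtain ⟨j, hj, rfl⟩ := mem_playPath_fst hx
        exact hk j (by omega))
      (hk k (by omega))
    rw [← add_assoc, playPath, ih, playPath]
    simp only [List.append_assoc, Prod.mk.injEq, true_and]
    exact hstep.symm

theorem loopPG_Ω_le (wf : OPGwf M A) (hM : 1 ≤ M) (hq : QueryWF M A q) {v v' : V}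
    (h : (loopPG A i q).E v v') : (loopPG A i q).Ω v v' ≤ M := by
  rcases h with ⟨h, hv⟩ | ⟨hv, ⟨m, hm⟩, rfl⟩ | ⟨hv, hn, rfl⟩
  · simpa [loopPG, hv] using wf.prio_le _ _ h
  · simpa [loopPG, hv, hm] using hq _ hv m hm
  · simpa [loopPG, hv, hn] using hM

theorem segment_cases (wf : OPGwf M A) (hσe : IsEStrat (loopPG A i q) σe)
    (hσa : IsAStrat (loopPG A i q) σa) (hτe : IsEStrat A.toPreGame τe)
    (hτa : IsAStrat A.toPreGame τa)
    (hN : playPath (loopPG A i q) σe σa i N = (P, i))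
    (hm : ∀ h v, (∀ x ∈ h, x ∉ A.exits) → v ∉ A.exits →
      (if A.eve v then τe h v else τa h v) = if A.eve v then σe (P ++ h) v else σa (P ++ h) v)
    {w : ℕ → ℕ} (hw : w = fun n => (loopPG A i q).Ω (playSeq (loopPG A i q) σe σa i n)
      (playSeq (loopPG A i q) σe σa i (n + 1)))
    {d : Dom V} (hd : PlayDen A (playSeq A.toPreGame τe τa i) d) :
    (∃ m, (Even m ↔ d.Favourable q) ∧ IsLimMax w m) ∨
      ∃ j, (Even ((Finset.range (j + 1)).sup fun k => w (N + k)) ↔ d.Favourable q) ∧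
        ∃ P', IsRestart A i q σe σa (N + j + 1) P' := by
  have hseq : ∀ k, (∀ j < k, playSeq A.toPreGame τe τa i j ∉ A.exits) →
      playSeq (loopPG A i q) σe σa i (N + k) = playSeq A.toPreGame τe τa i k := by
    intro k hk
    simp only [playSeq, playPath_loop_eq hN hm hk]
  have hweight : ∀ k, (∀ j < k + 1, playSeq A.toPreGame τe τa i j ∉ A.exits) →
      w (N + k) = A.Ω (playSeq A.toPreGame τe τa i k) (playSeq A.toPreGame τe τa i (k + 1)) := by
    intro k hk
    rw [hw]
    simp only [add_assoc]
    rw [hseq k fun j hj => hk j (by omega), hseq (k + 1) hk]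
    simp [loopPG, hk k (by omega)]
  have hedge := playSeq_edge hσe hσa i
  rcases hd with ⟨j, hj, hbefore, rfl⟩ | hd
  · have hpj := hseq j hbefore
    cases hqj : q (playSeq A.toPreGame τe τa i j) with
    | some m' =>
      refine Or.inr ⟨j, ?_, (playPath (loopPG A i q) σe σa i (N + j + 1)).1, ?_, ?_⟩
      · have hlast : w (N + j) = m' := by
          rw [hw]
          simp only [hpj]
          simp [loopPG, hj, hqj]
        have hsup : ((Finset.range j).sup fun k => w (N + k)) =
            (Finset.range j).sup fun k => A.Ω (playSeq A.toPreGame τe τa i k)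
              (playSeq A.toPreGame τe τa i (k + 1)) := by
          refine Finset.sup_congr rfl fun k hk => hweight k fun l hl => hbefore l ?_
          have := Finset.mem_range.1 hk
          omega
        rw [Finset.range_add_one, Finset.sup_insert, hlast, hsup, sup_comm]
        simp [Dom.Favourable, hqj]
      · refine Prod.ext rfl ?_
        have h := hedge (N + j)
        rw [hpj] at h
        rcases h with ⟨-, h⟩ | ⟨-, -, h⟩ | ⟨-, h, -⟩
        · exact absurd hj h
        · exact h
        · simp [hqj] at h
      · intro x hx
        simp only [playPath, List.getLast?_append, List.getLast?_singleton, Option.some_or,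
          Option.mem_some_iff] at hx
        subst hx
        change playSeq (loopPG A i q) σe σa i (N + j) ∈ A.exits
        rw [hpj]
        exact hj
    | none =>
      refine Or.inl ⟨1, by simp [Dom.Favourable, hqj], ?_⟩
      have hstay : ∀ k, playSeq (loopPG A i q) σe σa i (N + j + k) =
          playSeq A.toPreGame τe τa i j := by
        intro k
        induction k with
        | zero => exact hpj
        | succ k ih =>
          have h := hedge (N + j + k)
          rw [ih] at h
          rcases h with ⟨-, h⟩ | ⟨-, ⟨_, h⟩, -⟩ | ⟨-, -, h⟩
          · exact absurd hj h
          · simp [hqj] at h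
          · exact h
      rw [← isLimMax_shift (N + j)]
      have : (fun k => w (N + j + k)) = fun _ => 1 := by
        funext k
        rw [hw]
        simp only [hstay k]
        simp [loopPG, hj, hqj]
      rw [this]
      exact isLimMax_const 1
  · have hno : ∀ j, playSeq A.toPreGame τe τa i j ∉ A.exits := hd.elim And.left And.left
    left
    obtain ⟨m, hlim⟩ := exists_isLimMax fun k => wf.prio_le _ _ (playSeq_edge hτe hτa i k)
    refine ⟨m, ?_, ?_⟩
    · rcases hd with ⟨-, ⟨m', hev, hm'⟩, rfl⟩ | ⟨-, hlose, rfl⟩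
      · rw [hlim.unique hm']
        simpa [Dom.Favourable] using hev
      · simp only [Dom.Favourable, iff_false]
        exact fun hev => hlose ⟨m, hev, hlim⟩
    · rw [← isLimMax_shift N]
      rwa [funext fun k => hweight k fun l _ => hno l]

theorem exists_isLimMax_loop (wf : OPGwf M A) (hM : 1 ≤ M) (hq : QueryWF M A q)
    (hσe : IsEStrat (loopPG A i q) σe) (hσa : IsAStrat (loopPG A i q) σa) (b : Prop)
    (hseg : ∀ N P, IsRestart A i q σe σa N P → ∃ τe τa, IsEStrat A.toPreGame τe ∧
      IsAStrat A.toPreGame τa ∧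
      (∀ h v, (∀ x ∈ h, x ∉ A.exits) → v ∉ A.exits →
        (if A.eve v then τe h v else τa h v) =
          if A.eve v then σe (P ++ h) v else σa (P ++ h) v) ∧
      ∃ d, PlayDen A (playSeq A.toPreGame τe τa i) d ∧ (d.Favourable q ↔ b)) :
    ∃ m, (Even m ↔ b) ∧ IsLimMax (fun n => (loopPG A i q).Ω
      (playSeq (loopPG A i q) σe σa i n) (playSeq (loopPG A i q) σe σa i (n + 1))) m := by
  refine exists_isLimMax_of_segments (fun n => loopPG_Ω_le wf hM hq (playSeq_edge hσe hσa i n))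
    (fun m => Even m ↔ b) {N | ∃ P, IsRestart A i q σe σa N P} ⟨[], rfl, by simp⟩ ?_
  rintro N ⟨P, hP⟩
  obtain ⟨τe, τa, hτe, hτa, hm, d, hd, hb⟩ := hseg N P hP
  rw [← hb]
  exact segment_cases wf hσe hσa hτe hτa hP.1 hm rfl hd

theorem winningNode_loopPG_of_favourable (wf : OPGwf M A) (hM : 1 ≤ M) (hq : QueryWF M A q)
    (hτe : IsEStrat A.toPreGame τe) (hfav : ∀ d ∈ denSet A τe i, d.Favourable q) :
    WinningNode (loopPG A i q) i := by
  let p : V → Bool := fun x => decide (x ∉ A.exits)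
  let σe : List V → V → V := fun h v =>
    if v ∈ A.exits then (if q v = none then v else i) else τe (h.rtakeWhile p) v
  have hσe : IsEStrat (loopPG A i q) σe := by
    intro h v hv
    by_cases hx : v ∈ A.exits
    · cases hqv : q v with
      | none => exact Or.inr (Or.inr ⟨hx, hqv, by simp [σe, hx, hqv]⟩)
      | some m => exact Or.inr (Or.inl ⟨hx, ⟨m, hqv⟩, by simp [σe, hx, hqv]⟩)
    · refine Or.inl ⟨?_, hx⟩
      simpa [σe, hx] using hτe _ v hv
  refine ⟨σe, hσe, fun σa hσa => ?_⟩
  obtain ⟨m, hev, hlim⟩ := exists_isLimMax_loop wf hM hq hσe hσa True fun N P hP => by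
    have hτa : IsAStrat A.toPreGame fun h v => σa (P ++ h) v := by
      intro h v hv
      have hx : v ∉ A.exits := fun hx => by
        simp [wf.ends_eve v (List.mem_append_right _ hx)] at hv
      rcases hσa (P ++ h) v hv with ⟨h, -⟩ | ⟨h, -⟩ | ⟨h, -⟩
      · exact h
      · exact absurd h hx
      · exact absurd h hx
    obtain ⟨d, hd⟩ := exists_playDen A (playSeq A.toPreGame τe (fun h v => σa (P ++ h) v) i)
    refine ⟨τe, _, hτe, hτa, fun h v hh hv => ?_, d, hd, iff_true_intro (hfav d ⟨_, hτa, hd⟩)⟩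
    have hsuf : (P ++ h).rtakeWhile p = h :=
      rtakeWhile_append_of_getLast? (by simpa [p] using hP.2) (by simpa [p] using hh)
    simp [σe, hv, hsuf]
  exact ⟨m, hev.2 trivial, hlim⟩

theorem exists_favourable_of_winningNode_loopPG (wf : OPGwf M A) (hM : 1 ≤ M)
    (hq : QueryWF M A q) (hwin : WinningNode (loopPG A i q) i) :
    ∃ τe, IsEStrat A.toPreGame τe ∧ ∀ d ∈ denSet A τe i, d.Favourable q := by
  obtain ⟨σe, hσe, hwin⟩ := hwin
  by_contra! hcon
  let p : V → Bool := fun x => decide (x ∉ A.exits)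
  let τe : List V → List V → V → V := fun P h v => if v ∈ A.exits then v else σe (P ++ h) v
  have hτe : ∀ P, IsEStrat A.toPreGame (τe P) := by
    intro P h v hv
    by_cases hx : v ∈ A.exits
    · simpa [τe, hx] using (wf.exit_self v hx).1
    · rcases hσe (P ++ h) v hv with ⟨h, -⟩ | ⟨h, -⟩ | ⟨h, -⟩
      · simpa [τe, hx] using h
      · exact absurd h hx
      · exact absurd h hx
  choose d hd hbad using fun P => hcon (τe P) (hτe P)
  choose τa hτa hden using hd
  let σa : List V → V → V := fun h v => τa (h.rdropWhile p) (h.rtakeWhile p) v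
  have hσa : IsAStrat (loopPG A i q) σa := by
    intro h v hv
    refine Or.inl ⟨hτa _ _ v hv, fun hx => ?_⟩
    have hev := wf.ends_eve v (List.mem_append_right _ hx)
    exact Bool.false_ne_true (hv.symm.trans hev)
  obtain ⟨m, hodd, hlim⟩ := exists_isLimMax_loop wf hM hq hσe hσa False fun N P hP => by
    refine ⟨τe P, τa P, hτe P, hτa P, fun h v hh hv => ?_, d P, hden P, iff_false_intro (hbad P)⟩
    have hP' : ∀ x ∈ P.getLast?, p x = false := by simpa [p] using hP.2
    have hh' : ∀ x ∈ h, p x = true := by simpa [p] using hh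
    simp [τe, σa, hv, rtakeWhile_append_of_getLast? hP' hh', rdropWhile_append_of_getLast? hP' hh']
  obtain ⟨m', hev, hlim'⟩ := hwin σa hσa
  exact hodd.1 (hlim.unique hlim' ▸ hev)

end Loop

/-- correctness of the loop construction: `i` is winning in
`L(A, i, q)` iff some result `r` with `A(q) ⪯_U r` is Pareto-optimal. -/
theorem loop_construction_correct {V : Type} (M : ℕ) (hM : Even M) (hM2 : 2 ≤ M)
    (A : PreOPG V) (wf : OPGwf M A) (i : V) (hi : i ∈ A.ent)
    (q : V → Option ℕ) (hq : QueryWF M A q) :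
    WinningNode (loopPG A i q) i ↔
      ∃ r, UpLE (queryDual A q) r ∧ r ∈ pareto A i := by
  constructor
  · intro hwin
    obtain ⟨τe, hτe, hfav⟩ := exists_favourable_of_winningNode_loopPG wf (by omega) hq hwin
    obtain ⟨r, hr, hle⟩ := exists_mem_pareto wf hτe i
    refine ⟨r, UpLE.trans (fun d hd => ?_) hle, hr⟩
    exact (favourable_iff (inDom_of_mem_denSet wf hτe hd.1)).1 (hfav d hd.1)
  · rintro ⟨r, hle, ⟨τe, hτe, rfl⟩, -⟩
    refine winningNode_loopPG_of_favourable wf (by omega) hq hτe fun d hd => ?_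
    have hfin : (denSet A τe i).Finite :=
      (finite_setOf_inDom M A).subset fun d hd => inDom_of_mem_denSet wf hτe hd
    exact (favourable_iff (inDom_of_mem_denSet wf hτe hd)).2 (hle.trans (upLE_minSet hfin) d hd)
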